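/- Consider the synchronous machine model in the dq-frame: differentiable functions δ, ω, i_d, i_q : ℝ → ℝ satisfying for all t: δ'(t) = ω(t) − ω_s, J·ω'(t) = −D·ω(t) − b·i_q(t), L·i_d'(t) = −R·i_d(t) + L·ω(t)·i_q(t) − R_L·I·sin(δ(t)), and L·i_q'(t) = −R·i_q(t) − L·ω(t)·i_d(t) + b·ω(t) − R_L·I·cos(δ(t)). Define V(t) = (1/2)·J·ω(t)² + (1/2)·L·i_d(t)² + (1/2)·L·i_q(t)², and define V_d(t) = R_L·(i_d(t) + I·sin(δ(t))), V_q(t) = R_L·(i_q(t) + I·cos(δ(t))), I_d(t) = I·sin(δ(t)), I_q(t) = I·cos(δ(t)). Then for all t, V'(t) ≤ V_d(t)·I_d(t) + V_q(t)·I_q(t). (Nonlinear negative-imaginary property from electromagnetic torque input u₂ = (V_d·I_d + V_q·I_q)/ω to rotor angle output y₂ = θ, whose supply rate ẏ₂·u₂ equals V_d·I_d + V_q·I_q.) -/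

import Mathlib

open Real

/-- Nonlinear negative-imaginary property of the synchronous machine dq-model:
with supply rate `ẏ₂ u₂ = V_d I_d + V_q I_q` (torque input, rotor angle output),
the storage function satisfies `V' ≤ V_d I_d + V_q I_q`. -/
theorem sm_nni
    (J L D R_s R_l R_L b I ω_s R : ℝ)
    (hJ : 0 < J) (hL : 0 < L) (hD : 0 < D)
    (hRs : 0 ≤ R_s) (hRl : 0 ≤ R_l) (hRL : 0 < R_L)
    (hR : R = R_s + R_l + R_L)
    (δ ω i_d i_q δ' ω' i_d' i_q' : ℝ → ℝ)
    (hδ : ∀ t, HasDerivAt δ (δ' t) t)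
    (hω : ∀ t, HasDerivAt ω (ω' t) t)
    (hid : ∀ t, HasDerivAt i_d (i_d' t) t)
    (hiq : ∀ t, HasDerivAt i_q (i_q' t) t)
    (heq1 : ∀ t, δ' t = ω t - ω_s)
    (heq2 : ∀ t, J * ω' t = -D * ω t - b * i_q t)
    (heq3 : ∀ t, L * i_d' t = -R * i_d t + L * ω t * i_q t - R_L * I * Real.sin (δ t))
    (heq4 : ∀ t, L * i_q' t = -R * i_q t - L * ω t * i_d t + b * ω t - R_L * I * Real.cos (δ t))
    (V_d V_q I_d I_q : ℝ → ℝ)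
    (hVd : ∀ t, V_d t = R_L * (i_d t + I * Real.sin (δ t)))
    (hVq : ∀ t, V_q t = R_L * (i_q t + I * Real.cos (δ t)))
    (hId : ∀ t, I_d t = I * Real.sin (δ t))
    (hIq : ∀ t, I_q t = I * Real.cos (δ t)) :
    ∀ t, deriv (fun s => (1/2) * J * ω s ^ 2 + (1/2) * L * i_d s ^ 2
            + (1/2) * L * i_q s ^ 2) t
      ≤ V_d t * I_d t + V_q t * I_q t := by
  intro t
  have h := ((((hω t).pow 2).const_mul ((1/2) * J)).add
    (((hid t).pow 2).const_mul ((1/2) * L))).add (((hiq t).pow 2).const_mul ((1/2) * L))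
  have hd : deriv (fun s => (1/2) * J * ω s ^ 2 + (1/2) * L * i_d s ^ 2
      + (1/2) * L * i_q s ^ 2) t
      = ω t * (J * ω' t) + i_d t * (L * i_d' t) + i_q t * (L * i_q' t) := by
    refine Eq.trans (HasDerivAt.deriv h) ?_
    push_cast
    ring
  rw [hd, heq2, heq3, heq4, hVd, hVq, hId, hIq, hR]
  have h1 : 0 ≤ D * ω t ^ 2 := by positivity
  have h2 : 0 ≤ (R_s + R_l) * (i_d t ^ 2 + i_q t ^ 2) := by positivity
  have h3 : 0 ≤ R_L * ((i_d t + I * Real.sin (δ t)) ^ 2 + (i_q t + I * Real.cos (δ t)) ^ 2) := by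
    positivity
  linarith
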